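/- arXiv:math/0501083 — 2 statements merged into one kernel-verified Lean document; each statement's English description precedes it below -/
import Mathlib

section
/- Let B be a unital complex Banach algebra, (A,E) a B-valued Banach noncommutative probability space, a ∈ A with E(a) invertible in B, N ≥ 1, and fix i ∈ I. Set α₀ = E(a). Then there exist bounded n-multilinear maps α_n : Bⁿ → B for n = 1, …, N such that, with X = Σ_{n=0}^{N} (V_{i,n}(α_n) + W_{i,n}(α_n)) ∈ B(𝔉), one has ℰ(b₀ X b₁ X ⋯ b_k X) = E(b₀ a b₁ a ⋯ b_k a) for all k ∈ {1,…,N} and all b₀, …, b_N ∈ B (elements of B acting on 𝔉 via λ). -/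
open scoped Topology ENNReal

noncomputable section

variable (B : Type*) [NormedRing B] [NormedAlgebra ℂ B] [CompleteSpace B]
variable (I : Type*) [DecidableEq I]

abbrev D := lp (fun _ : I => B) 1

def delta (i : I) : D B I := lp.single 1 i (1 : B)

def lsmul (b : B) (d : D B I) : D B I :=
  ⟨fun i => b * d i, by
    apply memℓp_gen
    have h1 : Summable fun i => ‖d i‖ ^ (1 : ℝ≥0∞).toReal :=
      (lp.memℓp d).summable (by norm_num)
    simp only [ENNReal.toReal_one, Real.rpow_one] at h1 ⊢
    exact Summable.of_nonneg_of_le (fun i => norm_nonneg _)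
      (fun i => norm_mul_le b (d i)) (h1.mul_left ‖b‖)⟩

/-- The Fock-space construction of Dykema's paper: `F` plays the role of
`𝔉 = BΩ ⊕ ⨁_{k ≥ 1} D^{⊗̂k} ⊗̂ B`, with `τ k d b₀` the elementary tensor
`d 0 ⊗ ⋯ ⊗ d k ⊗ b₀` (`k+1` factors from `D`), `lam` the left action of `B`,
`rho` the right action of `B`, `P` the projection onto `BΩ` and the operators
`L i`, `V i n αₙ`, `W i n αₙ` as defined in the paper. -/
structure FockSetup (F : Type*) [NormedAddCommGroup F] [NormedSpace ℂ F] [CompleteSpace F] where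
  Ω : F
  τ : (k : ℕ) → (Fin (k + 1) → D B I) → B → F
  lam : B →ₐ[ℂ] (F →L[ℂ] F)
  rho : B → (F →L[ℂ] F)
  P : F →L[ℂ] B
  L : I → (F →L[ℂ] F)
  V : (i : I) → (n : ℕ) → ContinuousMultilinearMap ℂ (fun _ : Fin n => B) B → (F →L[ℂ] F)
  W : (i : I) → (n : ℕ) → ContinuousMultilinearMap ℂ (fun _ : Fin n => B) B → (F →L[ℂ] F)
  dense_span : Dense (↑(Submodule.span ℂ
      ((Set.range fun b : B => lam b Ω) ∪
        {x | ∃ (k : ℕ) (d : Fin (k + 1) → D B I) (b₀ : B), x = τ k d b₀})) : Set F)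
  lam_tensor : ∀ (b : B) (k : ℕ) (d : Fin (k + 1) → D B I) (b₀ : B),
    lam b (τ k d b₀) = τ k (Function.update d 0 (lsmul B I b (d 0))) b₀
  rho_lam_omega : ∀ b b₀ : B, rho b (lam b₀ Ω) = lam (b₀ * b) Ω
  rho_tensor : ∀ (b : B) (k : ℕ) (d : Fin (k + 1) → D B I) (b₀ : B),
    rho b (τ k d b₀) = τ k d (b₀ * b)
  P_lam_omega : ∀ b : B, P (lam b Ω) = b
  P_tensor : ∀ (k : ℕ) (d : Fin (k + 1) → D B I) (b₀ : B), P (τ k d b₀) = 0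
  L_omega : ∀ (i : I) (b₀ : B), L i (lam b₀ Ω) = τ 0 (fun _ => delta B I i) b₀
  L_tensor : ∀ (i : I) (k : ℕ) (d : Fin (k + 1) → D B I) (b₀ : B),
    L i (τ k d b₀) = τ (k + 1) (Fin.cons (delta B I i) d) b₀
  V_zero : ∀ (i : I) (α : ContinuousMultilinearMap ℂ (fun _ : Fin 0 => B) B),
    V i 0 α = lam (α 0)
  W_zero : ∀ (i : I) (α : ContinuousMultilinearMap ℂ (fun _ : Fin 0 => B) B),
    W i 0 α = lam (α 0) * L i
  V_omega : ∀ (i : I) (n : ℕ), 1 ≤ n →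
    ∀ (α : ContinuousMultilinearMap ℂ (fun _ : Fin n => B) B) (b₀ : B),
      V i n α (lam b₀ Ω) = 0
  W_omega : ∀ (i : I) (n : ℕ), 1 ≤ n →
    ∀ (α : ContinuousMultilinearMap ℂ (fun _ : Fin n => B) B) (b₀ : B),
      W i n α (lam b₀ Ω) = 0
  V_tensor_lt : ∀ (i : I) (n : ℕ) (α : ContinuousMultilinearMap ℂ (fun _ : Fin n => B) B)
      (k : ℕ) (d : Fin (k + 1) → D B I) (b₀ : B), k + 1 < n →
    V i n α (τ k d b₀) = 0
  W_tensor_lt : ∀ (i : I) (n : ℕ) (α : ContinuousMultilinearMap ℂ (fun _ : Fin n => B) B)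
      (k : ℕ) (d : Fin (k + 1) → D B I) (b₀ : B), k + 1 < n →
    W i n α (τ k d b₀) = 0
  V_tensor_eq : ∀ (i : I) (k : ℕ) (α : ContinuousMultilinearMap ℂ (fun _ : Fin (k + 1) => B) B)
      (d : Fin (k + 1) → D B I) (b₀ : B),
    V i (k + 1) α (τ k d b₀) = lam (α (fun j => d j i) * b₀) Ω
  W_tensor_eq : ∀ (i : I) (k : ℕ) (α : ContinuousMultilinearMap ℂ (fun _ : Fin (k + 1) => B) B)
      (d : Fin (k + 1) → D B I) (b₀ : B),
    W i (k + 1) α (τ k d b₀) = lam (α (fun j => d j i)) (τ 0 (fun _ => delta B I i) b₀)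
  V_tensor_gt : ∀ (i : I) (n : ℕ), 1 ≤ n →
    ∀ (α : ContinuousMultilinearMap ℂ (fun _ : Fin n => B) B)
      (k : ℕ) (d : Fin (k + 1) → D B I) (b₀ : B) (h : n ≤ k),
    V i n α (τ k d b₀) =
      lam (α fun j => d (Fin.castLE (by omega) j) i)
        (τ (k - n) (fun j : Fin (k - n + 1) => d ⟨n + (j : ℕ), by omega⟩) b₀)
  W_tensor_gt : ∀ (i : I) (n : ℕ), 1 ≤ n →
    ∀ (α : ContinuousMultilinearMap ℂ (fun _ : Fin n => B) B)
      (k : ℕ) (d : Fin (k + 1) → D B I) (b₀ : B) (h : n ≤ k),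
    W i n α (τ k d b₀) =
      lam (α fun j => d (Fin.castLE (by omega) j) i)
        (τ (k - n + 1) (Fin.cons (delta B I i)
          (fun j : Fin (k - n + 1) => d ⟨n + (j : ℕ), by omega⟩)) b₀)

variable {B} {I}
variable {F : Type*} [NormedAddCommGroup F] [NormedSpace ℂ F] [CompleteSpace F]

/-- The expectation `ℰ(X) = P(XΩ)`. -/
def FockSetup.Ec (S : FockSetup B I F) (X : F →L[ℂ] F) : B := S.P (X S.Ω)

variable (B) in
/-- A `B`-valued Banach noncommutative probability space structure on `A`. -/
structure NCPS (A : Type*) [NormedRing A] [NormedAlgebra ℂ A] [CompleteSpace A] where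
  ι : B →ₐ[ℂ] A
  isometry : Isometry ι
  E : A →L[ℂ] B
  E_ι : ∀ b : B, E (ι b) = b
  cond_exp : ∀ (a : A) (b₁ b₂ : B), E (ι b₁ * a * ι b₂) = b₁ * E a * b₂

set_option linter.unusedSectionVars false

namespace FockSetup

variable (S : FockSetup B I F)

/-- The operator `∑_{n=0}^{N} (V_{i,n}(αₙ) + W_{i,n}(αₙ))`. -/
def partialSum (i : I) (α : (n : ℕ) → ContinuousMultilinearMap ℂ (fun _ : Fin n => B) B)
    (N : ℕ) : F →L[ℂ] F :=
  ∑ n ∈ Finset.range (N + 1), (S.V i n (α n) + S.W i n (α n))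

/-- The span of `BΩ` and of the elementary tensors with at most `m` factors from `D`. -/
def degreeLE (m : ℕ) : Submodule ℂ F :=
  Submodule.span ℂ ((Set.range fun b : B => S.lam b S.Ω) ∪
    {x | ∃ (k : ℕ) (d : Fin (k + 1) → D B I) (b₀ : B), k + 1 ≤ m ∧ x = S.τ k d b₀})

variable {S}

theorem lam_omega_mem (m : ℕ) (b : B) : S.lam b S.Ω ∈ S.degreeLE m :=
  Submodule.subset_span (Or.inl ⟨b, rfl⟩)

theorem tensor_mem {m k : ℕ} (h : k + 1 ≤ m) (d : Fin (k + 1) → D B I) (b₀ : B) :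
    S.τ k d b₀ ∈ S.degreeLE m :=
  Submodule.subset_span (Or.inr ⟨k, d, b₀, h, rfl⟩)

theorem omega_mem (m : ℕ) : S.Ω ∈ S.degreeLE m := by
  simpa using lam_omega_mem (S := S) m 1

theorem degreeLE_mono {m r : ℕ} (h : m ≤ r) : S.degreeLE m ≤ S.degreeLE r := by
  refine Submodule.span_mono (Set.union_subset_union_right _ ?_)
  rintro x ⟨k, d, b₀, hk, rfl⟩
  exact ⟨k, d, b₀, by omega, rfl⟩

theorem map_degreeLE {m r : ℕ} (T : F →L[ℂ] F)
    (h₀ : ∀ b, T (S.lam b S.Ω) ∈ S.degreeLE r)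
    (h₁ : ∀ (k : ℕ) (d : Fin (k + 1) → D B I) (b₀ : B), k + 1 ≤ m →
      T (S.τ k d b₀) ∈ S.degreeLE r)
    {v : F} (hv : v ∈ S.degreeLE m) : T v ∈ S.degreeLE r := by
  have : S.degreeLE m ≤ (S.degreeLE r).comap (T : F →ₗ[ℂ] F) := by
    refine Submodule.span_le.2 ?_
    rintro x (⟨b, rfl⟩ | ⟨k, d, b₀, hk, rfl⟩)
    · exact h₀ b
    · exact h₁ k d b₀ hk
  exact this hv

theorem eqOn_degreeLE {G : Type*} [NormedAddCommGroup G] [NormedSpace ℂ G] {m : ℕ}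
    (T T' : F →L[ℂ] G) (h₀ : ∀ b, T (S.lam b S.Ω) = T' (S.lam b S.Ω))
    (h₁ : ∀ (k : ℕ) (d : Fin (k + 1) → D B I) (b₀ : B), k + 1 ≤ m →
      T (S.τ k d b₀) = T' (S.τ k d b₀))
    {v : F} (hv : v ∈ S.degreeLE m) : T v = T' v := by
  have : S.degreeLE m ≤ LinearMap.eqLocus (T : F →ₗ[ℂ] G) (T' : F →ₗ[ℂ] G) := by
    refine Submodule.span_le.2 ?_
    rintro x (⟨b, rfl⟩ | ⟨k, d, b₀, hk, rfl⟩)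
    · exact h₀ b
    · exact h₁ k d b₀ hk
  exact this hv

theorem lam_lam (b b' : B) (v : F) : S.lam b (S.lam b' v) = S.lam (b * b') v := by
  rw [map_mul]; rfl

theorem lam_mem {m : ℕ} (b : B) {v : F} (hv : v ∈ S.degreeLE m) :
    S.lam b v ∈ S.degreeLE m := by
  refine map_degreeLE (S.lam b) (fun b' => ?_) (fun k d b₀ hk => ?_) hv
  · rw [lam_lam]; exact lam_omega_mem _ _
  · rw [S.lam_tensor]; exact tensor_mem hk _ _

theorem L_mem {m : ℕ} (i : I) {v : F} (hv : v ∈ S.degreeLE m) :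
    S.L i v ∈ S.degreeLE (m + 1) := by
  refine map_degreeLE (S.L i) (fun b' => ?_) (fun k d b₀ hk => ?_) hv
  · rw [S.L_omega]; exact tensor_mem (by omega) _ _
  · rw [S.L_tensor]; exact tensor_mem (by omega) _ _

theorem V_mem {m : ℕ} (i : I) (n : ℕ) (α : ContinuousMultilinearMap ℂ (fun _ : Fin n => B) B)
    {v : F} (hv : v ∈ S.degreeLE m) : S.V i n α v ∈ S.degreeLE m := by
  rcases Nat.eq_zero_or_pos n with rfl | hn
  · rw [S.V_zero]; exact lam_mem _ hv
  refine map_degreeLE (S.V i n α) (fun b' => ?_) (fun k d b₀ hk => ?_) hv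
  · rw [S.V_omega i n hn]; exact zero_mem _
  · rcases lt_trichotomy (k + 1) n with h | rfl | h
    · rw [S.V_tensor_lt i n α k d b₀ h]; exact zero_mem _
    · rw [S.V_tensor_eq]; exact lam_omega_mem _ _
    · rw [S.V_tensor_gt i n hn α k d b₀ (by omega)]
      exact lam_mem _ (tensor_mem (by omega) _ _)

theorem W_mem {m : ℕ} (i : I) (n : ℕ) (hn : 1 ≤ n)
    (α : ContinuousMultilinearMap ℂ (fun _ : Fin n => B) B)
    {v : F} (hv : v ∈ S.degreeLE m) : S.W i n α v ∈ S.degreeLE m := by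
  refine map_degreeLE (S.W i n α) (fun b' => ?_) (fun k d b₀ hk => ?_) hv
  · rw [S.W_omega i n hn]; exact zero_mem _
  · rcases lt_trichotomy (k + 1) n with h | rfl | h
    · rw [S.W_tensor_lt i n α k d b₀ h]; exact zero_mem _
    · rw [S.W_tensor_eq]; exact lam_mem _ (tensor_mem (by omega) _ _)
    · rw [S.W_tensor_gt i n hn α k d b₀ (by omega)]
      exact lam_mem _ (tensor_mem (by omega) _ _)

theorem V_eq_zero {m : ℕ} (i : I) (n : ℕ) (hn : m < n)
    (α : ContinuousMultilinearMap ℂ (fun _ : Fin n => B) B)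
    {v : F} (hv : v ∈ S.degreeLE m) : S.V i n α v = 0 :=
  eqOn_degreeLE (S.V i n α) 0 (fun b => S.V_omega i n (by omega) α b)
    (fun k d b₀ hk => S.V_tensor_lt i n α k d b₀ (by omega)) hv

theorem W_eq_zero {m : ℕ} (i : I) (n : ℕ) (hn : m < n)
    (α : ContinuousMultilinearMap ℂ (fun _ : Fin n => B) B)
    {v : F} (hv : v ∈ S.degreeLE m) : S.W i n α v = 0 :=
  eqOn_degreeLE (S.W i n α) 0 (fun b => S.W_omega i n (by omega) α b)
    (fun k d b₀ hk => S.W_tensor_lt i n α k d b₀ (by omega)) hv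

theorem P_lam {m : ℕ} (b : B) {v : F} (hv : v ∈ S.degreeLE m) :
    S.P (S.lam b v) = b * S.P v := by
  refine eqOn_degreeLE (S.P ∘L S.lam b) (ContinuousLinearMap.mul ℂ B b ∘L S.P)
    (fun b' => ?_) (fun k d b₀ hk => ?_) hv
  · simp only [ContinuousLinearMap.comp_apply, lam_lam, S.P_lam_omega,
      ContinuousLinearMap.mul_apply']
  · simp [S.lam_tensor, S.P_tensor]

/-- The creation part of `partialSum` is `λ(α₀) L_i`; the rest does not raise the degree. -/
theorem partialSum_sub_mem {m : ℕ} (i : I)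
    (α : (n : ℕ) → ContinuousMultilinearMap ℂ (fun _ : Fin n => B) B) (N : ℕ)
    {v : F} (hv : v ∈ S.degreeLE m) :
    S.partialSum i α N v - S.lam (α 0 0) (S.L i v) ∈ S.degreeLE m := by
  have h : S.partialSum i α N v - S.lam (α 0 0) (S.L i v) =
      (∑ n ∈ Finset.range N, (S.V i (n + 1) (α (n + 1)) v + S.W i (n + 1) (α (n + 1)) v))
        + S.V i 0 (α 0) v := by
    simp only [partialSum, Finset.sum_range_succ', S.W_zero, add_apply,
      sum_apply, mul_apply_eq_comp]
    abel
  rw [h]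
  exact add_mem (sum_mem fun n _ => add_mem (V_mem _ _ _ hv) (W_mem _ _ (by omega) _ hv))
    (V_mem _ _ _ hv)

theorem partialSum_mem {m : ℕ} (i : I)
    (α : (n : ℕ) → ContinuousMultilinearMap ℂ (fun _ : Fin n => B) B) (N : ℕ)
    {v : F} (hv : v ∈ S.degreeLE m) : S.partialSum i α N v ∈ S.degreeLE (m + 1) := by
  rw [← sub_add_cancel (S.partialSum i α N v) (S.lam (α 0 0) (S.L i v))]
  exact add_mem (degreeLE_mono m.le_succ (partialSum_sub_mem i α N hv)) (lam_mem _ (L_mem i hv))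

variable (S) in
/-- The vector `b₀ X b₁ X ⋯ b_{k-1} X Ω`. -/
def word (X : F →L[ℂ] F) {k : ℕ} (b : Fin k → B) : F :=
  (List.ofFn fun j => S.lam (b j) * X).prod S.Ω

theorem word_zero (X : F →L[ℂ] F) (b : Fin 0 → B) : S.word X b = S.Ω := by
  simp [word]

theorem word_succ (X : F →L[ℂ] F) {k : ℕ} (b : Fin (k + 1) → B) :
    S.word X b = S.lam (b 0) (X (S.word X fun j => b j.succ)) := by
  simp [word, List.ofFn_succ]

theorem word_mem (i : I) (α : (n : ℕ) → ContinuousMultilinearMap ℂ (fun _ : Fin n => B) B)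
    (N : ℕ) {k : ℕ} (b : Fin k → B) : S.word (S.partialSum i α N) b ∈ S.degreeLE k := by
  induction k with
  | zero => rw [word_zero]; exact omega_mem _
  | succ k ih => rw [word_succ]; exact lam_mem _ (partialSum_mem i α N (ih _))

theorem word_congr {X X' : F →L[ℂ] F} {m : ℕ} (h : ∀ v ∈ S.degreeLE m, X' v = X v)
    (hX : ∀ (k : ℕ) (b : Fin k → B), k ≤ m → S.word X b ∈ S.degreeLE m)
    {k : ℕ} (hk : k ≤ m + 1) (b : Fin k → B) : S.word X' b = S.word X b := by
  induction k with
  | zero => simp [word_zero]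
  | succ k ih =>
    rw [word_succ, word_succ, ih (by omega), h _ (hX _ _ (by omega))]

theorem delta_self (i : I) : (delta B I i) i = 1 := by
  simp [delta]

/-- The top-degree component of a word is the tensor obtained by creating at each step. -/
theorem word_top (i : I) (α : (n : ℕ) → ContinuousMultilinearMap ℂ (fun _ : Fin n => B) B)
    (N : ℕ) {k : ℕ} (b : Fin (k + 1) → B) :
    ∃ d : Fin (k + 1) → D B I, (∀ j, d j i = b j * α 0 0) ∧
      S.word (S.partialSum i α N) b - S.τ k d 1 ∈ S.degreeLE k := by
  have key : ∀ (k : ℕ) (b : B) (v : F) (d : Fin (k + 1) → D B I),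
      v ∈ S.degreeLE k → d 0 i = 1 → S.L i v - S.τ k d 1 ∈ S.degreeLE k →
      ∃ d' : Fin (k + 1) → D B I, d' 0 i = b * α 0 0 ∧ (∀ j, j ≠ 0 → d' j = d j) ∧
        S.lam b (S.partialSum i α N v) - S.τ k d' 1 ∈ S.degreeLE k := by
    intro k b v d hv hd hL
    refine ⟨Function.update d 0 (lsmul B I (b * α 0 0) (d 0)), ?_, ?_, ?_⟩
    · simp [lsmul, hd]
    · intro j hj; simp [hj]
    · rw [← S.lam_tensor]
      have := add_mem (lam_mem b (partialSum_sub_mem i α N hv)) (lam_mem (b * α 0 0) hL)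
      convert this using 1
      simp only [map_sub, lam_lam]
      abel
  induction k with
  | zero =>
    have hL : S.L i S.Ω = S.τ 0 (fun _ => delta B I i) 1 := by
      simpa using S.L_omega i 1
    obtain ⟨d', h0, -, h⟩ := key 0 (b 0) S.Ω (fun _ => delta B I i) (omega_mem _)
      (delta_self i) (by rw [hL, sub_self]; exact zero_mem _)
    refine ⟨d', fun j => ?_, ?_⟩
    · rw [Fin.fin_one_eq_zero j]; exact h0
    · rw [word_succ, word_zero]; exact h
  | succ k ih =>
    obtain ⟨d, hd, hw⟩ := ih fun j => b j.succ
    obtain ⟨d', h0, h1, h⟩ := key (k + 1) (b 0) _ (Fin.cons (delta B I i) d)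
      (word_mem i α N fun j : Fin (k + 1) => b j.succ) (delta_self i) (by
        rw [← S.L_tensor, ← map_sub]; exact L_mem i hw)
    refine ⟨d', fun j => ?_, ?_⟩
    · refine Fin.cases h0 (fun j => ?_) j
      rw [h1 _ (Fin.succ_ne_zero j), Fin.cons_succ, hd]
    · rw [word_succ]; exact h

section Continuity

variable {Z : Type*} [TopologicalSpace Z]

variable (S Z) in
/-- Families of vectors spanned by the elementary tensors whose last factor and whose `i`-th
coordinates depend continuously on a parameter. -/
def contFamilies (i : I) : Submodule ℂ (Z → F) :=
  Submodule.span ℂ ({f | ∃ b : Z → B, Continuous b ∧ f = fun z => S.lam (b z) S.Ω} ∪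
    {f | ∃ (k : ℕ) (d : Z → Fin (k + 1) → D B I) (b₀ : Z → B),
      (∀ j, Continuous fun z => d z j i) ∧ Continuous b₀ ∧ f = fun z => S.τ k (d z) (b₀ z)})

theorem contFamilies_omega {i : I} {b : Z → B} (hb : Continuous b) :
    (fun z => S.lam (b z) S.Ω) ∈ S.contFamilies Z i :=
  Submodule.subset_span (Or.inl ⟨b, hb, rfl⟩)

theorem contFamilies_tensor {i : I} {k : ℕ} {d : Z → Fin (k + 1) → D B I} {b₀ : Z → B}
    (hd : ∀ j, Continuous fun z => d z j i) (hb : Continuous b₀) :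
    (fun z => S.τ k (d z) (b₀ z)) ∈ S.contFamilies Z i :=
  Submodule.subset_span (Or.inr ⟨k, d, b₀, hd, hb, rfl⟩)

theorem map_contFamilies {i : I} (T : Z → F →L[ℂ] F)
    (h₀ : ∀ b : Z → B, Continuous b → (fun z => T z (S.lam (b z) S.Ω)) ∈ S.contFamilies Z i)
    (h₁ : ∀ (k : ℕ) (d : Z → Fin (k + 1) → D B I) (b₀ : Z → B),
      (∀ j, Continuous fun z => d z j i) → Continuous b₀ →
      (fun z => T z (S.τ k (d z) (b₀ z))) ∈ S.contFamilies Z i)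
    {f : Z → F} (hf : f ∈ S.contFamilies Z i) :
    (fun z => T z (f z)) ∈ S.contFamilies Z i := by
  induction hf using Submodule.span_induction with
  | mem f hf =>
    rcases hf with ⟨b, hb, rfl⟩ | ⟨k, d, b₀, hd, hb, rfl⟩
    · exact h₀ b hb
    · exact h₁ k d b₀ hd hb
  | zero =>
    simp only [Pi.zero_apply, map_zero]
    exact zero_mem _
  | add f g _ _ hf hg =>
    simp only [Pi.add_apply, map_add]
    exact add_mem hf hg
  | smul c f _ hf =>
    simp only [Pi.smul_apply, map_smul]
    exact Submodule.smul_mem _ c hf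

theorem lam_contFamilies {i : I} {b : Z → B} (hb : Continuous b) {f : Z → F}
    (hf : f ∈ S.contFamilies Z i) : (fun z => S.lam (b z) (f z)) ∈ S.contFamilies Z i := by
  refine map_contFamilies (fun z => S.lam (b z)) (fun b' hb' => ?_)
    (fun k d b₀ hd hb₀ => ?_) hf
  · simp only [lam_lam]; exact contFamilies_omega (hb.mul hb')
  · simp only [S.lam_tensor]
    refine contFamilies_tensor (fun j => ?_) hb₀
    rcases eq_or_ne j 0 with rfl | hj
    · simp only [Function.update_self, lsmul]
      exact hb.mul (hd 0)
    · simpa [hj] using hd j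

theorem L_contFamilies {i : I} {f : Z → F} (hf : f ∈ S.contFamilies Z i) :
    (fun z => S.L i (f z)) ∈ S.contFamilies Z i := by
  refine map_contFamilies (fun _ => S.L i) (fun b' hb' => ?_) (fun k d b₀ hd hb₀ => ?_) hf
  · simp only [S.L_omega]
    exact contFamilies_tensor (fun _ => continuous_const) hb'
  · simp only [S.L_tensor]
    exact contFamilies_tensor
      (fun j => Fin.cases (by simpa using continuous_const) (fun j => by simpa using hd j) j) hb₀

theorem V_contFamilies {i : I} (n : ℕ)
    (α : ContinuousMultilinearMap ℂ (fun _ : Fin n => B) B) {f : Z → F}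
    (hf : f ∈ S.contFamilies Z i) : (fun z => S.V i n α (f z)) ∈ S.contFamilies Z i := by
  rcases Nat.eq_zero_or_pos n with rfl | hn
  · simp only [S.V_zero]; exact lam_contFamilies continuous_const hf
  refine map_contFamilies (fun _ => S.V i n α) (fun b' hb' => ?_) (fun k d b₀ hd hb₀ => ?_) hf
  · simp only [S.V_omega i n hn]; exact zero_mem _
  · rcases lt_trichotomy (k + 1) n with h | rfl | h
    · simp only [S.V_tensor_lt i n α k _ _ h]; exact zero_mem _
    · simp only [S.V_tensor_eq]
      exact contFamilies_omega ((α.cont.comp (continuous_pi hd)).mul hb₀)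
    · simp only [S.V_tensor_gt i n hn α k _ _ (Nat.lt_succ_iff.1 h)]
      exact lam_contFamilies (α.cont.comp (continuous_pi fun j => hd _))
        (contFamilies_tensor (fun j => hd _) hb₀)

theorem W_contFamilies {i : I} (n : ℕ)
    (α : ContinuousMultilinearMap ℂ (fun _ : Fin n => B) B) {f : Z → F}
    (hf : f ∈ S.contFamilies Z i) : (fun z => S.W i n α (f z)) ∈ S.contFamilies Z i := by
  rcases Nat.eq_zero_or_pos n with rfl | hn
  · simp only [S.W_zero]; exact lam_contFamilies continuous_const (L_contFamilies hf)
  refine map_contFamilies (fun _ => S.W i n α) (fun b' hb' => ?_) (fun k d b₀ hd hb₀ => ?_) hf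
  · simp only [S.W_omega i n hn]; exact zero_mem _
  · rcases lt_trichotomy (k + 1) n with h | rfl | h
    · simp only [S.W_tensor_lt i n α k _ _ h]; exact zero_mem _
    · simp only [S.W_tensor_eq]
      exact lam_contFamilies (α.cont.comp (continuous_pi hd))
        (contFamilies_tensor (fun _ => continuous_const) hb₀)
    · simp only [S.W_tensor_gt i n hn α k _ _ (Nat.lt_succ_iff.1 h)]
      exact lam_contFamilies (α.cont.comp (continuous_pi fun j => hd _))
        (contFamilies_tensor
          (fun j => Fin.cases (by simpa using continuous_const) (fun j => by simpa using hd _) j)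
          hb₀)

theorem partialSum_contFamilies {i : I}
    (α : (n : ℕ) → ContinuousMultilinearMap ℂ (fun _ : Fin n => B) B) (N : ℕ) {f : Z → F}
    (hf : f ∈ S.contFamilies Z i) :
    (fun z => S.partialSum i α N (f z)) ∈ S.contFamilies Z i := by
  have := sum_mem (t := Finset.range (N + 1)) fun n _ =>
    add_mem (V_contFamilies n (α n) hf) (W_contFamilies n (α n) hf)
  convert this using 1
  ext z
  simp [partialSum]

theorem word_contFamilies (i : I)
    (α : (n : ℕ) → ContinuousMultilinearMap ℂ (fun _ : Fin n => B) B) (N : ℕ) {k : ℕ}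
    {b : Z → Fin k → B} (hb : ∀ j, Continuous fun z => b z j) :
    (fun z => S.word (S.partialSum i α N) (b z)) ∈ S.contFamilies Z i := by
  induction k with
  | zero =>
    simp only [word_zero]
    simpa using contFamilies_omega (S := S) (i := i) (continuous_const (y := (1 : B)))
  | succ k ih =>
    simp only [word_succ]
    exact lam_contFamilies (hb 0) (partialSum_contFamilies α N (ih fun j => hb _))

theorem continuous_P {i : I} {f : Z → F} (hf : f ∈ S.contFamilies Z i) :
    Continuous fun z => S.P (f z) := by
  induction hf using Submodule.span_induction with
  | mem f hf =>
    rcases hf with ⟨b, hb, rfl⟩ | ⟨k, d, b₀, hd, hb, rfl⟩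
    · simpa only [S.P_lam_omega] using hb
    · simpa only [S.P_tensor] using continuous_const
  | zero => simpa using continuous_const
  | add f g _ _ hf hg =>
    simp only [Pi.add_apply, map_add]
    exact hf.add hg
  | smul c f _ hf =>
    simp only [Pi.smul_apply, map_smul]
    exact hf.const_smul c

end Continuity

variable (S) in
/-- The multilinear map `c ↦ P(X c₁u X ⋯ c_nu X Ω)` for `X = partialSum i α N`. -/
def wordMultilinear (i : I)
    (α : (n : ℕ) → ContinuousMultilinearMap ℂ (fun _ : Fin n => B) B) (N n : ℕ) (u : B) :
    ContinuousMultilinearMap ℂ (fun _ : Fin n => B) B where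
  toMultilinearMap :=
    ((S.P ∘L S.partialSum i α N ∘L ContinuousLinearMap.apply ℂ F S.Ω :
      (F →L[ℂ] F) →L[ℂ] B) : (F →L[ℂ] F) →ₗ[ℂ] B).compMultilinearMap
    ((MultilinearMap.mkPiAlgebraFin ℂ n (F →L[ℂ] F)).compLinearMap fun _ =>
      LinearMap.mulRight ℂ (S.partialSum i α N) ∘ₗ S.lam.toLinearMap ∘ₗ LinearMap.mulRight ℂ u)
  cont := continuous_P (partialSum_contFamilies α N (word_contFamilies i α N
    (b := fun (c : Fin n → B) j => c j * u) fun j => (continuous_apply j).mul continuous_const))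

theorem wordMultilinear_apply (i : I)
    (α : (n : ℕ) → ContinuousMultilinearMap ℂ (fun _ : Fin n => B) B) (N n : ℕ) (u : B)
    (c : Fin n → B) : S.wordMultilinear i α N n u c =
      S.P (S.partialSum i α N (S.word (S.partialSum i α N) fun j => c j * u)) :=
  rfl

theorem P_partialSum_word_succ (i : I)
    (α : (n : ℕ) → ContinuousMultilinearMap ℂ (fun _ : Fin n => B) B) (N : ℕ)
    (b : Fin (N + 1) → B) :
    S.P (S.partialSum i α (N + 1) (S.word (S.partialSum i α N) b)) =
      S.P (S.partialSum i α N (S.word (S.partialSum i α N) b)) +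
        α (N + 1) fun j => b j * α 0 0 := by
  obtain ⟨d, hd, hw⟩ := word_top (S := S) i α N b
  have hV := V_eq_zero i (N + 1) (by omega) (α (N + 1)) hw
  have hW := W_eq_zero i (N + 1) (by omega) (α (N + 1)) hw
  rw [map_sub, sub_eq_zero] at hV hW
  have h : S.partialSum i α (N + 1) =
      S.partialSum i α N + (S.V i (N + 1) (α (N + 1)) + S.W i (N + 1) (α (N + 1))) :=
    Finset.sum_range_succ _ _
  rw [h]
  simp only [add_apply, map_add, hV, hW, S.V_tensor_eq, S.W_tensor_eq,
    S.P_lam_omega, S.lam_tensor, S.P_tensor, hd, mul_one, add_zero]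

theorem partialSum_succ_apply {i : I}
    (α : (n : ℕ) → ContinuousMultilinearMap ℂ (fun _ : Fin n => B) B) {N : ℕ} {v : F}
    (hv : v ∈ S.degreeLE N) : S.partialSum i α (N + 1) v = S.partialSum i α N v := by
  have h : S.partialSum i α (N + 1) =
      S.partialSum i α N + (S.V i (N + 1) (α (N + 1)) + S.W i (N + 1) (α (N + 1))) :=
    Finset.sum_range_succ _ _
  simp [h, V_eq_zero i (N + 1) (by omega) (α (N + 1)) hv,
    W_eq_zero i (N + 1) (by omega) (α (N + 1)) hv]

theorem word_partialSum_succ (i : I)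
    (α : (n : ℕ) → ContinuousMultilinearMap ℂ (fun _ : Fin n => B) B) {N k : ℕ}
    (hk : k ≤ N + 1) (b : Fin k → B) :
    S.word (S.partialSum i α (N + 1)) b = S.word (S.partialSum i α N) b :=
  word_congr (fun _ hv => partialSum_succ_apply α hv)
    (fun _ b hk => degreeLE_mono hk (word_mem i α N b)) hk b

theorem partialSum_congr (i : I)
    {α α' : (n : ℕ) → ContinuousMultilinearMap ℂ (fun _ : Fin n => B) B} {N : ℕ}
    (h : ∀ n ≤ N, α n = α' n) : S.partialSum i α N = S.partialSum i α' N :=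
  Finset.sum_congr rfl fun n hn => by
    rw [h n (Nat.lt_succ_iff.1 (Finset.mem_range.1 hn))]

end FockSetup

namespace NCPS

variable {A : Type*} [NormedRing A] [NormedAlgebra ℂ A] [CompleteSpace A]

theorem E_ι_mul (P : NCPS B A) (b : B) (x : A) : P.E (P.ι b * x) = b * P.E x := by
  simpa using P.cond_exp x b 1

/-- The multilinear map `c ↦ E(a c₁u a ⋯ c_nu a)`. -/
def momentMultilinear (P : NCPS B A) (a : A) (n : ℕ) (u : B) :
    ContinuousMultilinearMap ℂ (fun _ : Fin n => B) B :=
  (P.E ∘L ContinuousLinearMap.mul ℂ A a).compContinuousMultilinearMap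
    ((ContinuousMultilinearMap.mkPiAlgebraFin ℂ n A).compContinuousLinearMap fun _ =>
      (ContinuousLinearMap.mul ℂ A).flip a ∘L
        (⟨P.ι.toLinearMap, P.isometry.continuous⟩ : B →L[ℂ] A) ∘L
          (ContinuousLinearMap.mul ℂ B).flip u)

theorem momentMultilinear_apply (P : NCPS B A) (a : A) (n : ℕ) (u : B) (c : Fin n → B) :
    P.momentMultilinear a n u c = P.E (a * (List.ofFn fun j => P.ι (c j * u) * a).prod) :=
  rfl

end NCPS

open FockSetup in
theorem exists_partialSum_moments {A : Type*} [NormedRing A] [NormedAlgebra ℂ A]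
    [CompleteSpace A] (P : NCPS B A) (S : FockSetup B I F) (a : A) (ha : IsUnit (P.E a))
    (i : I) (N : ℕ) :
    ∃ α : (n : ℕ) → ContinuousMultilinearMap ℂ (fun _ : Fin n => B) B,
      α 0 0 = P.E a ∧ ∀ k ≤ N, ∀ b : Fin (k + 1) → B,
        S.P (S.word (S.partialSum i α N) b) =
          P.E (List.ofFn fun j => P.ι (b j) * a).prod := by
  induction N with
  | zero =>
    refine ⟨fun n => Nat.casesOn n
      (ContinuousMultilinearMap.constOfIsEmpty ℂ _ (P.E a)) fun _ => 0, rfl, ?_⟩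
    rintro k hk b
    obtain rfl : k = 0 := by omega
    rw [word_succ, word_zero, P_lam _ (partialSum_mem i _ 0 (omega_mem 0))]
    have hV : S.V i 0 (ContinuousMultilinearMap.constOfIsEmpty ℂ _ (P.E a)) S.Ω
        = S.lam (P.E a) S.Ω := by
      rw [S.V_zero]; rfl
    have hW : S.P (S.W i 0 (ContinuousMultilinearMap.constOfIsEmpty ℂ _ (P.E a)) S.Ω) = 0 := by
      have hL := S.L_omega i 1
      rw [map_one] at hL
      rw [S.W_zero, mul_apply_eq_comp]
      erw [hL]
      rw [S.lam_tensor, S.P_tensor]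
    simp [partialSum, hV, hW, S.P_lam_omega, P.E_ι_mul]
  | succ N ih =>
    obtain ⟨α, h0, hα⟩ := ih
    obtain ⟨u, hu⟩ := ha.exists_right_inv
    set β := P.momentMultilinear a (N + 1) u - S.wordMultilinear i α N (N + 1) u with hβ
    set α' := Function.update α (N + 1) β with hα'
    have h0' : α' 0 0 = P.E a := by
      rw [hα', Function.update_of_ne (by omega), h0]
    have hX : S.partialSum i α' N = S.partialSum i α N :=
      partialSum_congr i fun n hn => Function.update_of_ne (by omega) _ _
    refine ⟨α', h0', fun k hk b => ?_⟩
    rcases Nat.lt_or_ge N k with h | h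
    · obtain rfl : k = N + 1 := by omega
      rw [word_succ, word_partialSum_succ i α' le_rfl,
        P_lam _ (partialSum_mem i α' (N + 1) (word_mem i α' N _)), P_partialSum_word_succ, hX,
        h0', List.ofFn_succ, List.prod_cons, mul_assoc, P.E_ι_mul]
      congr 1
      rw [hα', Function.update_self, hβ, sub_apply,
        NCPS.momentMultilinear_apply, wordMultilinear_apply]
      simp only [mul_assoc, hu, mul_one]
      abel
    · rw [word_partialSum_succ i α' (by omega), hX]
      exact hα k h b

/-- Proposition 3.5: moments of an element `a` with `E(a)` invertible can be matched, up to
order `N`, by an operator `X = ∑_{n=0}^{N} (V_{i,n}(αₙ) + W_{i,n}(αₙ))` on the Fock space,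
where `α₀ = E(a)`. -/
theorem stmt_10 {A : Type*} [NormedRing A] [NormedAlgebra ℂ A] [CompleteSpace A]
    (P : NCPS B A) (S : FockSetup B I F) (a : A) (ha : IsUnit (P.E a))
    (N : ℕ) (hN : 1 ≤ N) (i : I) :
    ∃ α : (n : ℕ) → ContinuousMultilinearMap ℂ (fun _ : Fin n => B) B,
      α 0 0 = P.E a ∧
      ∀ X : F →L[ℂ] F, X = ∑ n ∈ Finset.range (N + 1), (S.V i n (α n) + S.W i n (α n)) →
        ∀ k : ℕ, 1 ≤ k → k ≤ N → ∀ b : Fin (k + 1) → B,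
          S.Ec (List.ofFn fun j => S.lam (b j) * X).prod =
            P.E (List.ofFn fun j => P.ι (b j) * a).prod := by
  obtain ⟨α, h0, hα⟩ := exists_partialSum_moments P S a ha i N
  refine ⟨α, h0, ?_⟩
  rintro X rfl k - hk b
  exact hα k hk b
end
end

section
/- Let B be a unital complex Banach algebra, I a set, N ≥ 1, and for every n ∈ {0,1,…,N} let α_n be a bounded n-multilinear map Bⁿ → B (with α₀ ∈ B). Fix i ∈ I and set X = L_i + Σ_{n=0}^{N−1} V_{i,n}(α_n) and Y = X + V_{i,N}(α_N). Then for all b₀, …, b_N ∈ B, ℰ(b₀ Y b₁ Y ⋯ b_N Y) = b₀ α_N(b₁, b₂, …, b_N) + ℰ(b₀ X b₁ X ⋯ b_N X), where elements of B act on 𝔉 via λ. -/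
open scoped Topology ENNReal

noncomputable section

variable (B : Type*) [NormedRing B] [NormedAlgebra ℂ B] [CompleteSpace B]
variable (I : Type*) [DecidableEq I]

variable {B} {I}
variable {F : Type*} [NormedAddCommGroup F] [NormedSpace ℂ F] [CompleteSpace F]

namespace FockSetup

variable (S : FockSetup B I F)

/-- The span of `BΩ` and of the elementary tensors with at most `m` factors from `D`. -/
def lowerSpan (m : ℕ) : Submodule ℂ F :=
  Submodule.span ℂ ((Set.range fun b : B => S.lam b S.Ω) ∪
    {x | ∃ (k : ℕ) (d : Fin (k + 1) → D B I) (b₀ : B), k < m ∧ x = S.τ k d b₀})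

lemma lam_omega_mem_lowerSpan (m : ℕ) (b : B) : S.lam b S.Ω ∈ S.lowerSpan m :=
  Submodule.subset_span (Or.inl ⟨b, rfl⟩)

lemma omega_mem_lowerSpan (m : ℕ) : S.Ω ∈ S.lowerSpan m := by
  simpa using S.lam_omega_mem_lowerSpan m 1

lemma tensor_mem_lowerSpan {m k : ℕ} (h : k < m) (d : Fin (k + 1) → D B I) (b₀ : B) :
    S.τ k d b₀ ∈ S.lowerSpan m :=
  Submodule.subset_span (Or.inr ⟨k, d, b₀, h, rfl⟩)

lemma lowerSpan_mapsTo (T : F →L[ℂ] F) {m : ℕ} {G : Submodule ℂ F}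
    (hΩ : ∀ b, T (S.lam b S.Ω) ∈ G)
    (hτ : ∀ (k : ℕ) (d : Fin (k + 1) → D B I) (b₀ : B), k < m → T (S.τ k d b₀) ∈ G)
    {x : F} (hx : x ∈ S.lowerSpan m) : T x ∈ G := by
  have h : S.lowerSpan m ≤ G.comap (T : F →ₗ[ℂ] F) := by
    refine Submodule.span_le.2 ?_
    rintro _ (⟨b, rfl⟩ | ⟨k, d, b₀, hk, rfl⟩)
    · exact hΩ b
    · exact hτ k d b₀ hk
  exact h hx

lemma lam_mem_lowerSpan (b : B) {m : ℕ} {x : F} (hx : x ∈ S.lowerSpan m) :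
    S.lam b x ∈ S.lowerSpan m := by
  refine S.lowerSpan_mapsTo _ (fun c => ?_) (fun k d b₀ hk => ?_) hx
  · simpa using S.lam_omega_mem_lowerSpan m (b * c)
  · rw [S.lam_tensor]
    exact S.tensor_mem_lowerSpan hk _ _

lemma L_mem_lowerSpan (i : I) {m : ℕ} {x : F} (hx : x ∈ S.lowerSpan m) :
    S.L i x ∈ S.lowerSpan (m + 1) := by
  refine S.lowerSpan_mapsTo _ (fun c => ?_) (fun k d b₀ hk => ?_) hx
  · rw [S.L_omega]
    exact S.tensor_mem_lowerSpan (by omega) _ _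
  · rw [S.L_tensor]
    exact S.tensor_mem_lowerSpan (by omega) _ _

lemma V_mem_lowerSpan (i : I) (n : ℕ)
    (α : ContinuousMultilinearMap ℂ (fun _ : Fin n => B) B) {m : ℕ} {x : F}
    (hx : x ∈ S.lowerSpan m) : S.V i n α x ∈ S.lowerSpan m := by
  rcases n with _ | n
  · rw [S.V_zero]
    exact S.lam_mem_lowerSpan _ hx
  refine S.lowerSpan_mapsTo _ (fun c => ?_) (fun k d b₀ hk => ?_) hx
  · rw [S.V_omega i _ (by omega)]
    exact zero_mem _
  · rcases lt_trichotomy k n with h | rfl | h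
    · rw [S.V_tensor_lt i _ _ _ _ _ (by omega)]
      exact zero_mem _
    · rw [S.V_tensor_eq]
      exact S.lam_omega_mem_lowerSpan _ _
    · rw [S.V_tensor_gt i _ (by omega) _ _ _ _ (by omega)]
      exact S.lam_mem_lowerSpan _ (S.tensor_mem_lowerSpan (by omega) _ _)

lemma V_eq_zero_of_mem_lowerSpan (i : I) {n : ℕ}
    (α : ContinuousMultilinearMap ℂ (fun _ : Fin n => B) B) {m : ℕ} (h : m < n) {x : F}
    (hx : x ∈ S.lowerSpan m) : S.V i n α x = 0 := by
  refine (Submodule.mem_bot ℂ).1 (S.lowerSpan_mapsTo _ (fun c => ?_) (fun k d b₀ hk => ?_) hx)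
  · rw [S.V_omega i _ (by omega)]
    exact zero_mem _
  · rw [S.V_tensor_lt i _ _ _ _ _ (by omega)]
    exact zero_mem _

lemma sum_V_mem_lowerSpan (i : I) (s : Finset ℕ)
    (α : (n : ℕ) → ContinuousMultilinearMap ℂ (fun _ : Fin n => B) B) {m : ℕ} {x : F}
    (hx : x ∈ S.lowerSpan m) : (∑ n ∈ s, S.V i n (α n)) x ∈ S.lowerSpan m := by
  rw [sum_apply]
  exact Submodule.sum_mem _ fun n _ => S.V_mem_lowerSpan i n (α n) hx

lemma lam_tensor_cons (b : B) (m : ℕ) (e : D B I) (d : Fin (m + 1) → D B I) (b₀ : B) :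
    S.lam b (S.τ (m + 1) (Fin.cons e d) b₀) = S.τ (m + 1) (Fin.cons (lsmul B I b e) d) b₀ := by
  rw [S.lam_tensor]
  simp

lemma prod_ofFn_succ_apply (T : F →L[ℂ] F) {m : ℕ} (b : Fin (m + 1) → B) (x : F) :
    (List.ofFn fun j => S.lam (b j) * T).prod x =
      S.lam (b 0) (T ((List.ofFn fun j => S.lam (b (Fin.succ j)) * T).prod x)) := by
  rw [List.ofFn_succ, List.prod_cons]
  rfl

/-- The leading term of a word in `L i` and the operators `V i n (α n)` applied to the vacuum. -/
lemma prod_omega_sub_tensor_mem_lowerSpan (i : I) (s : Finset ℕ)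
    (α : (n : ℕ) → ContinuousMultilinearMap ℂ (fun _ : Fin n => B) B) (m : ℕ)
    (b : Fin (m + 1) → B) :
    (List.ofFn fun j => S.lam (b j) * (S.L i + ∑ n ∈ s, S.V i n (α n))).prod S.Ω -
      S.τ m (fun j => lsmul B I (b j) (delta B I i)) 1 ∈ S.lowerSpan m := by
  set T := ∑ n ∈ s, S.V i n (α n)
  induction m with
  | zero =>
    have hL : S.lam (b 0) (S.L i S.Ω) = S.τ 0 (fun j => lsmul B I (b j) (delta B I i)) 1 := by
      have h := S.L_omega i 1
      simp only [map_one, one_apply_eq_self] at h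
      rw [h, S.lam_tensor]
      congr 1
      funext j
      fin_cases j
      simp
    have h : S.lam (b 0) (T S.Ω) ∈ S.lowerSpan 0 :=
      S.lam_mem_lowerSpan _ (S.sum_V_mem_lowerSpan i s α (S.omega_mem_lowerSpan 0))
    simpa [hL] using h
  | succ m ih =>
    have hr := ih fun j => b j.succ
    set y := (List.ofFn fun j => S.lam (b (Fin.succ j)) * (S.L i + T)).prod S.Ω
    set t := S.τ m (fun j => lsmul B I (b j.succ) (delta B I i)) 1 with ht
    have hyt : y ∈ S.lowerSpan (m + 1) := by
      have h : S.lowerSpan m ≤ S.lowerSpan (m + 1) := Submodule.span_mono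
        (Set.union_subset_union_right _ fun x ⟨k, d, b₀, hk, hx⟩ => ⟨k, d, b₀, by omega, hx⟩)
      exact ((S.lowerSpan (m + 1)).sub_mem_iff_left
        (S.tensor_mem_lowerSpan m.lt_succ_self _ 1)).1 (h hr)
    have hlead : S.τ (m + 1) (fun j => lsmul B I (b j) (delta B I i)) 1 =
        S.lam (b 0) (S.L i t) := by
      rw [ht, S.L_tensor, S.lam_tensor_cons]
      congr 1
      funext j
      refine Fin.cases ?_ (fun j => ?_) j <;> simp
    have hprod : (List.ofFn fun j => S.lam (b j) * (S.L i + T)).prod S.Ω =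
        S.lam (b 0) (S.L i y + T y) := by
      rw [S.prod_ofFn_succ_apply]
      rfl
    have hdiff : S.lam (b 0) (S.L i y + T y) - S.lam (b 0) (S.L i t) =
        S.lam (b 0) (S.L i (y - t) + T y) := by
      rw [← map_sub, map_sub (S.L i)]
      congr 1
      abel
    rw [hlead, hprod, hdiff]
    exact S.lam_mem_lowerSpan _
      (add_mem (S.L_mem_lowerSpan i hr) (S.sum_V_mem_lowerSpan i s α hyt))

lemma lsmul_delta_apply_self (b : B) (i : I) : lsmul B I b (delta B I i) i = b := by
  change b * (delta B I i) i = b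
  simp [delta]

/-- Words with fewer letters than the degree do not see the top-degree annihilation term. -/
lemma prod_add_V_omega (i : I) (s : Finset ℕ) {N : ℕ}
    (α : (n : ℕ) → ContinuousMultilinearMap ℂ (fun _ : Fin n => B) B) (m : ℕ) (hm : m < N)
    (b : Fin (m + 1) → B) :
    (List.ofFn fun j =>
      S.lam (b j) * (S.L i + ∑ n ∈ s, S.V i n (α n) + S.V i N (α N))).prod S.Ω =
    (List.ofFn fun j => S.lam (b j) * (S.L i + ∑ n ∈ s, S.V i n (α n))).prod S.Ω := by
  induction m with
  | zero =>
    simp [S.V_eq_zero_of_mem_lowerSpan i (α N) hm (S.omega_mem_lowerSpan 0)]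
  | succ m ih =>
    have h := S.V_eq_zero_of_mem_lowerSpan i (α N) (by omega)
      (S.prod_omega_sub_tensor_mem_lowerSpan i s α m fun j => b j.succ)
    rw [map_sub, S.V_tensor_lt i _ _ _ _ _ hm, sub_zero] at h
    rw [S.prod_ofFn_succ_apply (S.L i + _ + S.V i N (α N)), ih (by omega),
      S.prod_ofFn_succ_apply (S.L i + ∑ n ∈ s, S.V i n (α n)) b,
      add_apply _ (S.V i N (α N)), h, add_zero]

end FockSetup

/-- Lemma 4.3 (the R-transform analogue of Lemma 3.4): adding the top-degree annihilation term
changes the `N`-th moment by exactly `b₀ α_N(b₁, …, b_N)`. -/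
theorem stmt_15 (S : FockSetup B I F) (N : ℕ) (hN : 1 ≤ N)
    (α : (n : ℕ) → ContinuousMultilinearMap ℂ (fun _ : Fin n => B) B) (i : I)
    (X Y : F →L[ℂ] F)
    (hX : X = S.L i + ∑ n ∈ Finset.range N, S.V i n (α n))
    (hY : Y = X + S.V i N (α N))
    (b : Fin (N + 1) → B) :
    S.Ec (List.ofFn fun j => S.lam (b j) * Y).prod =
      b 0 * α N (fun j : Fin N => b j.succ) +
        S.Ec (List.ofFn fun j => S.lam (b j) * X).prod := by
  obtain ⟨m, rfl⟩ : ∃ m, N = m + 1 := ⟨N - 1, by omega⟩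
  subst hX hY
  have h := S.V_eq_zero_of_mem_lowerSpan i (α (m + 1)) m.lt_succ_self
    (S.prod_omega_sub_tensor_mem_lowerSpan i (Finset.range (m + 1)) α m fun j => b j.succ)
  rw [map_sub, S.V_tensor_eq, sub_eq_zero] at h
  simp only [FockSetup.lsmul_delta_apply_self, mul_one] at h
  rw [FockSetup.Ec, FockSetup.Ec,
    S.prod_ofFn_succ_apply (S.L i + _ + S.V i (m + 1) (α (m + 1))),
    S.prod_add_V_omega i _ α m m.lt_succ_self,
    S.prod_ofFn_succ_apply (S.L i + ∑ n ∈ Finset.range (m + 1), S.V i n (α n)) b,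
    add_apply _ (S.V i (m + 1) (α (m + 1))), h,
    map_add, map_add, ← mul_apply_eq_comp (S.lam (b 0)) (S.lam _), ← map_mul,
    S.P_lam_omega, add_comm]
end
end
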